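/- For every n ≥ 1, every N ∈ ℕ, every f ∈ E_N and every real a ≥ √n · √(2N+1), one has ∫_{|x| ≥ a} |f(x)|² dx ≤ (2ⁿ n^{3/2} / √π) · (e^{−a²/(2n)} / a) · 8^N · ‖f‖²_{L²(ℝⁿ)}, where |x| denotes the Euclidean norm on ℝⁿ. -/

import Mathlib

open MeasureTheory

noncomputable section

/-- The one-dimensional Hermite functions
`φ_k(x) = ((-1)^k / √(2^k k! √π)) e^{x²/2} (d/dx)^k e^{-x²}`. -/
def hermiteFn (k : ℕ) (x : ℝ) : ℝ :=
  ((-1 : ℝ) ^ k / Real.sqrt (2 ^ k * Nat.factorial k * Real.sqrt Real.pi)) *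
    Real.exp (x ^ 2 / 2) * iteratedDeriv k (fun y => Real.exp (-(y ^ 2))) x

/-- The `n`-dimensional Hermite functions `Φ_α(x) = ∏_j φ_{α_j}(x_j)`, viewed as
complex-valued functions. -/
def hermitePhi {n : ℕ} (α : Fin n → ℕ) (x : EuclideanSpace ℝ (Fin n)) : ℂ :=
  ∏ j, (hermiteFn (α j) (x j) : ℂ)

/-- `E_N`, the span of the Hermite functions `Φ_α` with `|α| ≤ N`. -/
def hermiteSpan (n N : ℕ) : Submodule ℂ (EuclideanSpace ℝ (Fin n) → ℂ) :=
  Submodule.span ℂ {f | ∃ α : Fin n → ℕ, (∑ j, α j) ≤ N ∧ f = hermitePhi α}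

end

lemma hasDerivAt_neg_sq (x : ℝ) : HasDerivAt (fun x : ℝ => -(x ^ 2)) (-(2 * x)) x := by
  simpa using (hasDerivAt_pow 2 x).fun_neg

open Polynomial in
/-- Physicist Hermite polynomials. -/
noncomputable def physH : ℕ → Polynomial ℝ
  | 0 => 1
  | (k + 1) => 2 * X * physH k - derivative (physH k)

open Polynomial in
lemma physH_deriv (k : ℕ) : derivative (physH (k + 1)) = C (2 * ((k : ℝ) + 1)) * physH k := by
  induction k with
  | zero => simp [physH]; rfl
  | succ k ih =>
    have h1 : physH (k + 2) = 2 * X * physH (k + 1) - derivative (physH (k + 1)) := rfl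
    have h2 : physH (k + 1) = 2 * X * physH k - derivative (physH k) := rfl
    rw [h1, derivative_sub, ih]
    simp only [derivative_mul, derivative_C, derivative_X, derivative_ofNat, ih]
    rw [h2]
    push_cast
    simp only [C_mul, C_add, C_1, C_ofNat, map_natCast]
    ring

open Polynomial in
lemma physH_iter (k : ℕ) : derivative^[k] (physH k) = C (2 ^ k * (Nat.factorial k : ℝ)) := by
  induction k with
  | zero => simp [physH]
  | succ k ih =>
    rw [Function.iterate_succ_apply, physH_deriv, iterate_derivative_C_mul, ih, ← C_mul]
    congr 1
    rw [Nat.factorial_succ]; push_cast; ring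

open Polynomial in
lemma physH_iter_zero (j m : ℕ) : derivative^[j + 1 + m] (physH j) = 0 := by
  rw [add_comm, Function.iterate_add_apply, Function.iterate_succ_apply', physH_iter, derivative_C]
  simp

lemma physH_gauss (k : ℕ) (x : ℝ) :
    iteratedDeriv k (fun y => Real.exp (-(y ^ 2))) x =
      (-1) ^ k * ((physH k).eval x * Real.exp (-(x ^ 2))) := by
  induction k generalizing x with
  | zero => simp [physH]
  | succ k ih =>
    rw [iteratedDeriv_succ, funext ih]
    have h : HasDerivAt (fun x : ℝ => (-1 : ℝ) ^ k * ((physH k).eval x * Real.exp (-(x ^ 2))))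
        ((-1 : ℝ) ^ k * ((physH k).derivative.eval x * Real.exp (-(x ^ 2)) +
          (physH k).eval x * (Real.exp (-(x ^ 2)) * (-(2 * x))))) x := by
      refine HasDerivAt.const_mul _ (((physH k).hasDerivAt x).mul (HasDerivAt.exp ?_))
      exact hasDerivAt_neg_sq x
    rw [h.deriv, physH, pow_succ]
    simp
    ring

lemma hermiteFn_eq (k : ℕ) (x : ℝ) :
    hermiteFn k x = (physH k).eval x * Real.exp (-(x ^ 2) / 2) /
      Real.sqrt (2 ^ k * Nat.factorial k * Real.sqrt Real.pi) := by
  have h1 : Real.exp (-(x ^ 2) / 2) = Real.exp (x ^ 2 / 2) * Real.exp (-(x ^ 2)) := by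
    rw [← Real.exp_add]; congr 1; ring
  have h2 : ((-1 : ℝ) ^ k) * (-1) ^ k = 1 := by rw [← mul_pow]; simp
  rw [hermiteFn, physH_gauss, h1]
  linear_combination (Real.exp (x ^ 2 / 2) * (physH k).eval x * Real.exp (-(x ^ 2)) /
    Real.sqrt (2 ^ k * Nat.factorial k * Real.sqrt Real.pi)) * h2

lemma integrable_pow_gauss (k : ℕ) {b : ℝ} (hb : 0 < b) :
    Integrable (fun x : ℝ => x ^ k * Real.exp (-b * x ^ 2)) := by
  simpa using integrable_rpow_mul_exp_neg_mul_sq hb (s := k) (by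
    have : (0 : ℝ) ≤ k := k.cast_nonneg
    linarith)

lemma integrable_poly_gauss (p : Polynomial ℂ) :
    Integrable (fun x : ℝ => p.eval (x : ℂ) * (Real.exp (-(x ^ 2)) : ℂ)) := by
  induction p using Polynomial.induction_on' with
  | add p q hp hq =>
    refine (hp.add hq).congr (Filter.Eventually.of_forall fun x => ?_)
    simp [add_mul]
  | monomial k c =>
    refine (((integrable_pow_gauss k one_pos).ofReal (𝕜 := ℂ)).const_mul c).congr
      (Filter.Eventually.of_forall fun x => ?_)
    simp [mul_assoc]

lemma integrable_rpoly_gauss (p : Polynomial ℝ) :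
    Integrable (fun x : ℝ => p.eval x * Real.exp (-(x ^ 2))) := by
  induction p using Polynomial.induction_on' with
  | add p q hp hq =>
    refine (hp.add hq).congr (Filter.Eventually.of_forall fun x => ?_)
    simp [add_mul]
  | monomial k c =>
    refine ((integrable_pow_gauss k one_pos).const_mul c).congr
      (Filter.Eventually.of_forall fun x => ?_)
    simp [mul_assoc]

lemma integral_gauss_one : ∫ x : ℝ, Real.exp (-(x ^ 2)) = Real.sqrt Real.pi := by
  simpa using integral_gaussian 1

lemma gauss_ibp (q : Polynomial ℝ) (k : ℕ) :
    ∫ x : ℝ, q.eval x * ((physH (k + 1)).eval x * Real.exp (-(x ^ 2))) =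
      ∫ x : ℝ, (Polynomial.derivative q).eval x * ((physH k).eval x * Real.exp (-(x ^ 2))) := by
  have hv : ∀ x : ℝ, HasDerivAt (fun x : ℝ => -((physH k).eval x * Real.exp (-(x ^ 2))))
      ((physH (k + 1)).eval x * Real.exp (-(x ^ 2))) x := by
    intro x
    have h : HasDerivAt (fun x : ℝ => -((physH k).eval x * Real.exp (-(x ^ 2))))
        (-((physH k).derivative.eval x * Real.exp (-(x ^ 2)) +
          (physH k).eval x * (Real.exp (-(x ^ 2)) * (-(2 * x))))) x := by
      refine HasDerivAt.neg (((physH k).hasDerivAt x).mul (HasDerivAt.exp ?_))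
      exact hasDerivAt_neg_sq x
    convert h using 1
    simp [physH]
    ring
  have := integral_mul_deriv_eq_deriv_mul_of_integrable (A := ℝ)
    (u := fun x => q.eval x) (u' := fun x => (Polynomial.derivative q).eval x)
    (v := fun x : ℝ => -((physH k).eval x * Real.exp (-(x ^ 2))))
    (v' := fun x : ℝ => ((physH (k + 1)).eval x * Real.exp (-(x ^ 2))))
    (fun x _ => q.hasDerivAt x) (fun x _ => hv x)
    ((integrable_rpoly_gauss (q * physH (k + 1))).congr
      (Filter.Eventually.of_forall fun x => by simp [mul_assoc]))
    ((integrable_rpoly_gauss (-Polynomial.derivative q * physH k)).congr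
      (Filter.Eventually.of_forall fun x => by simp [mul_assoc]))
    ((integrable_rpoly_gauss (-q * physH k)).congr
      (Filter.Eventually.of_forall fun x => by simp [mul_assoc]))
  rw [this, ← integral_neg]
  simp

lemma gauss_ibp_iter (q : Polynomial ℝ) (k : ℕ) :
    ∫ x : ℝ, q.eval x * ((physH k).eval x * Real.exp (-(x ^ 2))) =
      ∫ x : ℝ, (Polynomial.derivative^[k] q).eval x * Real.exp (-(x ^ 2)) := by
  induction k generalizing q with
  | zero => simp [physH]
  | succ k ih => rw [gauss_ibp, ih, Function.iterate_succ_apply]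

lemma physH_orth_lt {j k : ℕ} (h : j < k) :
    ∫ x : ℝ, (physH j).eval x * ((physH k).eval x * Real.exp (-(x ^ 2))) = 0 := by
  obtain ⟨m, rfl⟩ := Nat.exists_eq_add_of_le (Nat.succ_le_of_lt h)
  rw [gauss_ibp_iter, Nat.succ_eq_add_one, physH_iter_zero]
  simp

lemma physH_norm (k : ℕ) :
    ∫ x : ℝ, (physH k).eval x * ((physH k).eval x * Real.exp (-(x ^ 2))) =
      2 ^ k * Nat.factorial k * Real.sqrt Real.pi := by
  rw [gauss_ibp_iter, physH_iter]
  simp only [Polynomial.eval_C]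
  rw [integral_const_mul, integral_gauss_one]

lemma hermiteFn_mul (j k : ℕ) (x : ℝ) : hermiteFn j x * hermiteFn k x =
    (Real.sqrt (2 ^ j * Nat.factorial j * Real.sqrt Real.pi))⁻¹ *
    (Real.sqrt (2 ^ k * Nat.factorial k * Real.sqrt Real.pi))⁻¹ *
    ((physH j).eval x * ((physH k).eval x * Real.exp (-(x ^ 2)))) := by
  have h1 : Real.exp (-(x ^ 2)) = Real.exp (-(x ^ 2) / 2) * Real.exp (-(x ^ 2) / 2) := by
    rw [← Real.exp_add]; congr 1; ring
  rw [hermiteFn_eq, hermiteFn_eq, h1]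
  ring

lemma hermiteFn_integrable (j k : ℕ) :
    Integrable (fun x => hermiteFn j x * hermiteFn k x) := by
  refine ((integrable_rpoly_gauss (physH j * physH k)).const_mul
    ((Real.sqrt (2 ^ j * Nat.factorial j * Real.sqrt Real.pi))⁻¹ *
    (Real.sqrt (2 ^ k * Nat.factorial k * Real.sqrt Real.pi))⁻¹)).congr
      (Filter.Eventually.of_forall fun x => ?_)
  simp only [hermiteFn_mul, Polynomial.eval_mul]
  ring

lemma hermiteFn_orth (j k : ℕ) :
    ∫ x, hermiteFn j x * hermiteFn k x = if j = k then 1 else 0 := by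
  simp_rw [hermiteFn_mul]
  rw [integral_const_mul]
  rcases lt_trichotomy j k with h | h | h
  · rw [physH_orth_lt h, if_neg h.ne, mul_zero]
  · subst h
    have hp : 0 < 2 ^ j * (Nat.factorial j : ℝ) * Real.sqrt Real.pi := by positivity
    rw [physH_norm, if_pos rfl, ← mul_inv, Real.mul_self_sqrt hp.le, inv_mul_cancel₀ hp.ne']
  · have : ∀ x : ℝ, (physH j).eval x * ((physH k).eval x * Real.exp (-(x ^ 2))) =
      (physH k).eval x * ((physH j).eval x * Real.exp (-(x ^ 2))) := fun x => by ring
    simp_rw [this]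
    rw [physH_orth_lt h, if_neg h.ne', mul_zero]

/-- The complex integral representing the Hermite polynomials. -/
noncomputable def hermI (x : ℝ) (k : ℕ) : ℂ :=
  ∫ y : ℝ, ((x : ℂ) + Complex.I * y) ^ k * (Real.exp (-(y ^ 2)) : ℂ)

lemma hermI_integrable (x : ℝ) (k : ℕ) :
    Integrable (fun y : ℝ => ((x : ℂ) + Complex.I * y) ^ k * (Real.exp (-(y ^ 2)) : ℂ)) := by
  refine (integrable_poly_gauss
    ((Polynomial.C (x : ℂ) + Polynomial.C Complex.I * Polynomial.X) ^ k)).congr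
      (Filter.Eventually.of_forall fun y => ?_)
  simp

lemma hermI_rec (x : ℝ) (k : ℕ) :
    hermI x (k + 2) = x * hermI x (k + 1) - ((k : ℂ) + 1) / 2 * hermI x k := by
  have hu : ∀ y : ℝ, HasDerivAt (fun y : ℝ => ((x : ℂ) + Complex.I * y) ^ (k + 1))
      (((k : ℂ) + 1) * ((x : ℂ) + Complex.I * y) ^ k * Complex.I) y := by
    intro y
    have h1 : HasDerivAt (fun y : ℝ => (x : ℂ) + Complex.I * y) Complex.I y := by
      simpa using ((Complex.ofRealCLM.hasDerivAt (x := y)).const_mul Complex.I).const_add (x : ℂ)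
    simpa using h1.fun_pow (k + 1)
  have hv : ∀ y : ℝ, HasDerivAt (fun y : ℝ => (Real.exp (-(y ^ 2)) : ℂ))
      ((-2 * y : ℂ) * (Real.exp (-(y ^ 2)) : ℂ)) y := by
    intro y
    have h : HasDerivAt (fun x : ℝ => Real.exp (-(x ^ 2)))
        (Real.exp (-(y ^ 2)) * (-(2 * y))) y := by
      refine HasDerivAt.exp ?_
      exact hasDerivAt_neg_sq y
    convert h.ofReal_comp using 1
    push_cast
    ring
  have hint : Integrable (fun y : ℝ => ((x : ℂ) + Complex.I * y) ^ (k + 1) *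
      ((-2 * y : ℂ) * (Real.exp (-(y ^ 2)) : ℂ))) := by
    refine (integrable_poly_gauss
      ((Polynomial.C (x : ℂ) + Polynomial.C Complex.I * Polynomial.X) ^ (k + 1) *
        (Polynomial.C (-2) * Polynomial.X))).congr
        (Filter.Eventually.of_forall fun y => ?_)
    simp [mul_assoc]
  have hint2 : Integrable (fun y : ℝ => ((k : ℂ) + 1) * ((x : ℂ) + Complex.I * y) ^ k *
      Complex.I * (Real.exp (-(y ^ 2)) : ℂ)) := by
    refine ((hermI_integrable x k).const_mul (((k : ℂ) + 1) * Complex.I)).congr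
        (Filter.Eventually.of_forall fun y => ?_)
    simp only []
    ring
  have ibp := integral_mul_deriv_eq_deriv_mul_of_integrable (A := ℂ)
    (fun y _ => hu y) (fun y _ => hv y) hint hint2 (hermI_integrable x (k + 1))
  have e1 : ∫ y : ℝ, ((k : ℂ) + 1) * ((x : ℂ) + Complex.I * y) ^ k *
      Complex.I * (Real.exp (-(y ^ 2)) : ℂ) = ((k : ℂ) + 1) * Complex.I * hermI x k := by
    rw [hermI, ← integral_const_mul]
    congr 1; ext y; ring
  rw [e1] at ibp
  have e2 : hermI x (k + 2) = x * hermI x (k + 1) + (-Complex.I / 2) *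
      ∫ y : ℝ, ((x : ℂ) + Complex.I * y) ^ (k + 1) *
      ((-2 * y : ℂ) * (Real.exp (-(y ^ 2)) : ℂ)) := by
    rw [hermI, hermI, ← integral_const_mul, ← integral_const_mul, ← integral_add
      ((hermI_integrable x (k + 1)).const_mul _) (hint.const_mul _)]
    congr 1; ext y; ring
  rw [e2, ibp]
  linear_combination ((k : ℂ) + 1) / 2 * hermI x k * Complex.I_sq

lemma hermI_zero (x : ℝ) : hermI x 0 = Real.sqrt Real.pi := by
  simp only [hermI, pow_zero, one_mul]
  rw [integral_complex_ofReal, integral_gauss_one]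

lemma hermI_one (x : ℝ) : hermI x 1 = x * Real.sqrt Real.pi := by
  have h0 : ∫ y : ℝ, y * Real.exp (-(y ^ 2)) = 0 := by
    have := integral_neg_eq_self (fun y : ℝ => y * Real.exp (-(y ^ 2))) volume
    simp only [neg_mul, even_two.neg_pow, integral_neg] at this
    linarith
  have h1 : Integrable (fun y : ℝ => y * Real.exp (-(y ^ 2))) := by
    simpa using integrable_pow_gauss 1 one_pos
  have h2 := hermI_integrable x 0
  simp only [pow_zero, one_mul] at h2
  have : hermI x 1 = x * (∫ y : ℝ, (Real.exp (-(y ^ 2)) : ℂ)) +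
      Complex.I * ∫ y : ℝ, ((y * Real.exp (-(y ^ 2)) : ℝ) : ℂ) := by
    rw [hermI, ← integral_const_mul, ← integral_const_mul]
    refine Eq.trans ?_ (integral_add (h2.const_mul _) (h1.ofReal.const_mul _))
    congr 1; ext y; push_cast; ring
  rw [this, integral_complex_ofReal, integral_complex_ofReal, integral_gauss_one, h0]
  simp

lemma hermI_eq (x : ℝ) (k : ℕ) :
    (2 : ℂ) ^ k * hermI x k = ((physH k).eval x * Real.sqrt Real.pi : ℝ) := by
  induction k using Nat.twoStepInduction with
  | zero => simp [hermI_zero, physH]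
  | one => simp [hermI_one, physH]; ring
  | more k h0 h1 =>
    have h : physH (k + 2) = 2 * Polynomial.X * physH (k + 1) -
        Polynomial.derivative (physH (k + 1)) := rfl
    rw [h, physH_deriv, hermI_rec]
    simp only [Polynomial.eval_sub, Polynomial.eval_mul, Polynomial.eval_C, Polynomial.eval_X,
      Polynomial.eval_ofNat]
    push_cast at h0 h1 ⊢
    linear_combination 2 * (x : ℂ) * h1 - 2 * ((k : ℂ) + 1) * h0

lemma hermI_sq_le (x : ℝ) (k : ℕ) : ‖hermI x k‖ ^ 2 ≤
    Real.sqrt Real.pi * ∫ y : ℝ, (x ^ 2 + y ^ 2) ^ k * Real.exp (-(y ^ 2)) := by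
  set s := Real.sqrt Real.pi with hs
  have hs0 : 0 < s := by positivity
  have hn : ∀ y : ℝ, ‖(x : ℂ) + Complex.I * y‖ ^ 2 = x ^ 2 + y ^ 2 := by
    intro y
    rw [← Complex.normSq_eq_norm_sq, mul_comm, Complex.normSq_add_mul_I]
  set g : ℝ → ℝ := fun y => ‖(x : ℂ) + Complex.I * y‖ ^ k with hg
  have hg2 : ∀ y, (x ^ 2 + y ^ 2) ^ k = g y ^ 2 := by
    intro y
    rw [← hn, hg]; ring
  have i1 : Integrable (fun y => g y * Real.exp (-(y ^ 2))) := by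
    refine (hermI_integrable x k).norm.congr (Filter.Eventually.of_forall fun y => ?_)
    simp only [norm_mul, norm_pow, hg, Complex.norm_real, Real.norm_eq_abs, Real.abs_exp]
  have i2 : Integrable (fun y => g y ^ 2 * Real.exp (-(y ^ 2))) := by
    simp_rw [← hg2]
    refine (integrable_rpoly_gauss ((Polynomial.C (x ^ 2) + Polynomial.X ^ 2) ^ k)).congr
      (Filter.Eventually.of_forall fun y => ?_)
    simp
  have i0 : Integrable (fun y : ℝ => Real.exp (-(y ^ 2))) := by
    simpa using integrable_exp_neg_mul_sq one_pos
  have hle : ‖hermI x k‖ ≤ ∫ y, g y * Real.exp (-(y ^ 2)) := by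
    refine (norm_integral_le_integral_norm _).trans (le_of_eq ?_)
    congr 1; ext y
    simp only [norm_mul, norm_pow, hg, Complex.norm_real, Real.norm_eq_abs, Real.abs_exp]
  simp_rw [hg2]
  set m := ∫ y, g y * Real.exp (-(y ^ 2)) with hm
  have hpos : 0 ≤ ∫ y, (s * g y - m) ^ 2 * Real.exp (-(y ^ 2)) :=
    integral_nonneg fun y => by positivity
  have hexp : ∫ y, (s * g y - m) ^ 2 * Real.exp (-(y ^ 2)) =
      s ^ 2 * (∫ y, g y ^ 2 * Real.exp (-(y ^ 2))) - 2 * s * m * m + m ^ 2 * s := by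
    have : ∀ y, (s * g y - m) ^ 2 * Real.exp (-(y ^ 2)) =
      s ^ 2 * (g y ^ 2 * Real.exp (-(y ^ 2))) - 2 * s * m * (g y * Real.exp (-(y ^ 2))) +
      m ^ 2 * Real.exp (-(y ^ 2)) := fun y => by ring
    simp_rw [this]
    rw [integral_add (f := fun y => s ^ 2 * (g y ^ 2 * Real.exp (-(y ^ 2))) -
        2 * s * m * (g y * Real.exp (-(y ^ 2)))) ((i2.const_mul _).sub (i1.const_mul _)) (i0.const_mul _),
      integral_sub (i2.const_mul _) (i1.const_mul _), integral_const_mul, integral_const_mul,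
      integral_const_mul, integral_gauss_one]
  rw [hexp] at hpos
  have h3 : m ^ 2 ≤ s * ∫ y, g y ^ 2 * Real.exp (-(y ^ 2)) := by
    by_contra hcon
    push Not at hcon
    nlinarith
  exact (pow_le_pow_left₀ (norm_nonneg _) hle 2).trans h3

lemma hermiteFn_sq_le (k : ℕ) (x : ℝ) : hermiteFn k x ^ 2 ≤
    Real.exp (-(x ^ 2)) / Real.pi *
      ∫ y : ℝ, (2 ^ k / Nat.factorial k) * ((x ^ 2 + y ^ 2) ^ k * Real.exp (-(y ^ 2))) := by
  have h := hermI_sq_le x k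
  have e : (2 : ℝ) ^ k * ‖hermI x k‖ = |(physH k).eval x| * Real.sqrt Real.pi := by
    have := congrArg norm (hermI_eq x k)
    rw [norm_mul, norm_pow, Complex.norm_real, norm_mul] at this
    simpa [abs_of_nonneg] using this
  have e2 : (2 : ℝ) ^ k * 2 ^ k * ‖hermI x k‖ ^ 2 = (physH k).eval x ^ 2 * Real.pi := by
    have : ((2 : ℝ) ^ k * ‖hermI x k‖) ^ 2 = (|(physH k).eval x| * Real.sqrt Real.pi) ^ 2 := by
      rw [e]
    rw [mul_pow, mul_pow, sq_abs, Real.sq_sqrt Real.pi_pos.le] at this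
    linarith
  rw [integral_const_mul]
  set J := ∫ y : ℝ, (x ^ 2 + y ^ 2) ^ k * Real.exp (-(y ^ 2))
  have hp : 0 < 2 ^ k * (Nat.factorial k : ℝ) * Real.sqrt Real.pi := by positivity
  have h1 : Real.exp (-(x ^ 2)) = Real.exp (-(x ^ 2) / 2) ^ 2 := by
    rw [sq (Real.exp _), ← Real.exp_add]; congr 1; ring
  rw [hermiteFn_eq, div_pow, mul_pow, Real.sq_sqrt hp.le, ← h1]
  have h3 : (physH k).eval x ^ 2 = 2 ^ k * 2 ^ k * ‖hermI x k‖ ^ 2 / Real.pi := by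
    rw [e2]; field_simp
  rw [h3]
  calc _ ≤ 2 ^ k * 2 ^ k * (Real.sqrt Real.pi * J) / Real.pi * Real.exp (-x ^ 2) /
      (2 ^ k * (Nat.factorial k : ℝ) * Real.sqrt Real.pi) := by gcongr
    _ = _ := by field_simp

lemma mehler_bound (N : ℕ) (x : ℝ) :
    ∑ k ∈ Finset.range N, (1 / 8 : ℝ) ^ k * hermiteFn k x ^ 2 ≤
      Real.sqrt (4 / (3 * Real.pi)) * Real.exp (-(3 / 4) * x ^ 2) := by
  have hi : ∀ k : ℕ, Integrable (fun y : ℝ => (1 / 8 : ℝ) ^ k * ((2 ^ k / Nat.factorial k) *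
      ((x ^ 2 + y ^ 2) ^ k * Real.exp (-(y ^ 2))))) := by
    intro k
    refine Integrable.const_mul (Integrable.const_mul ?_ _) _
    refine (integrable_rpoly_gauss ((Polynomial.C (x ^ 2) + Polynomial.X ^ 2) ^ k)).congr
      (Filter.Eventually.of_forall fun y => ?_)
    simp
  have h1 : ∑ k ∈ Finset.range N, (1 / 8 : ℝ) ^ k * hermiteFn k x ^ 2 ≤
      Real.exp (-(x ^ 2)) / Real.pi * ∫ y : ℝ, ∑ k ∈ Finset.range N,
        (1 / 8 : ℝ) ^ k * ((2 ^ k / Nat.factorial k) *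
      ((x ^ 2 + y ^ 2) ^ k * Real.exp (-(y ^ 2)))) := by
    rw [integral_finsetSum _ (fun k _ => hi k), Finset.mul_sum]
    refine Finset.sum_le_sum fun k _ => ?_
    rw [integral_const_mul]
    have := mul_le_mul_of_nonneg_left (hermiteFn_sq_le k x)
      (by positivity : (0 : ℝ) ≤ (1 / 8 : ℝ) ^ k)
    linarith
  have h2 : ∫ y : ℝ, ∑ k ∈ Finset.range N,
        (1 / 8 : ℝ) ^ k * ((2 ^ k / Nat.factorial k) *
      ((x ^ 2 + y ^ 2) ^ k * Real.exp (-(y ^ 2)))) ≤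
      ∫ y : ℝ, Real.exp (x ^ 2 / 4) * Real.exp (-(3 / 4) * y ^ 2) := by
    refine integral_mono (integrable_finsetSum _ fun k _ => hi k)
      ((integrable_exp_neg_mul_sq (by norm_num)).const_mul _) fun y => ?_
    have h3 := Real.sum_le_exp_of_nonneg (x := (x ^ 2 + y ^ 2) / 4) (by positivity) N
    have h4 : ∑ k ∈ Finset.range N,
        (1 / 8 : ℝ) ^ k * ((2 ^ k / Nat.factorial k) *
      ((x ^ 2 + y ^ 2) ^ k * Real.exp (-(y ^ 2)))) =
      (∑ k ∈ Finset.range N, ((x ^ 2 + y ^ 2) / 4) ^ k / Nat.factorial k) *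
        Real.exp (-(y ^ 2)) := by
      rw [Finset.sum_mul]
      refine Finset.sum_congr rfl fun k _ => ?_
      have : ((1 : ℝ) / 8) ^ k * 2 ^ k = (1 / 4) ^ k := by rw [← mul_pow]; norm_num
      rw [div_eq_mul_one_div (x ^ 2 + y ^ 2), mul_pow, ← this]
      ring
    simp only []
    rw [h4]
    refine (mul_le_mul_of_nonneg_right h3 (Real.exp_pos _).le).trans (le_of_eq ?_)
    rw [← Real.exp_add, ← Real.exp_add]; congr 1; ring
  refine (h1.trans (mul_le_mul_of_nonneg_left h2 (by positivity))).trans (le_of_eq ?_)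
  rw [integral_const_mul, integral_gaussian]
  have h5 : Real.exp (-(3 / 4) * x ^ 2) = Real.exp (-(x ^ 2)) * Real.exp (x ^ 2 / 4) := by
    rw [← Real.exp_add]; congr 1; ring
  have h6 : Real.sqrt (Real.pi / (3 / 4)) = Real.pi * Real.sqrt (4 / (3 * Real.pi)) := by
    rw [← Real.sqrt_sq Real.pi_pos.le, ← Real.sqrt_mul (by positivity),
      Real.sqrt_sq Real.pi_pos.le]
    congr 1
    field_simp
  rw [h5, h6]
  field_simp

lemma gauss_tail (b : ℝ) (hb : 0 < b) :
    ∫ t : ℝ, (if b ≤ |t| then Real.exp (-(3 / 4) * t ^ 2) else 0) ≤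
      4 / 3 * (Real.exp (-(3 / 4) * b ^ 2) / b) := by
  have h1 : ∫ t : ℝ, (if b ≤ |t| then Real.exp (-(3 / 4) * t ^ 2) else 0) =
      2 * ∫ t in Set.Ioi 0, (if b ≤ t then Real.exp (-(3 / 4) * t ^ 2) else 0) := by
    rw [← integral_comp_abs (f := fun t : ℝ => if b ≤ t then Real.exp (-(3 / 4) * t ^ 2) else 0)]
    simp only [sq_abs]
  have h2 : ∫ t in Set.Ioi 0, (if b ≤ t then Real.exp (-(3 / 4) * t ^ 2) else 0) =
      ∫ t in Set.Ioi b, Real.exp (-(3 / 4) * t ^ 2) := by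
    rw [← integral_Ici_eq_integral_Ioi (x := b), ← integral_indicator measurableSet_Ici,
      ← integral_indicator measurableSet_Ioi]
    congr 1; ext t
    by_cases ht : b ≤ t
    · have : 0 < t := hb.trans_le ht
      simp [Set.indicator, ht, this]
    · simp [Set.indicator, ht]
  have hi : IntegrableOn (fun t : ℝ => t * Real.exp (-(3 / 4) * t ^ 2)) (Set.Ioi b) := by
    have := integrable_pow_gauss 1 (b := 3 / 4) (by norm_num)
    simp only [pow_one] at this
    exact this.integrableOn
  have h3 : ∫ t in Set.Ioi b, t * Real.exp (-(3 / 4) * t ^ 2) =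
      2 / 3 * Real.exp (-(3 / 4) * b ^ 2) := by
    have := integral_Ioi_of_hasDerivAt_of_tendsto' (a := b) (m := 0)
      (f := fun t : ℝ => -(2 / 3) * Real.exp (-(3 / 4) * t ^ 2))
      (f' := fun t : ℝ => t * Real.exp (-(3 / 4) * t ^ 2)) ?_ hi ?_
    · rw [this]; ring
    · intro x _
      have h := (((hasDerivAt_pow 2 x).const_mul (-(3 / 4 : ℝ))).exp).const_mul (-(2 / 3 : ℝ))
      have e : -(2 / 3) * (Real.exp (-(3 / 4) * x ^ 2) * (-(3 / 4) * (((2 : ℕ) : ℝ) * x ^ (2 - 1)))) =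
          x * Real.exp (-(3 / 4) * x ^ 2) := by
        push_cast
        ring
      rw [e] at h
      exact h
    · rw [show (0 : ℝ) = -(2 / 3) * 0 by simp]
      refine Filter.Tendsto.const_mul _ (Real.tendsto_exp_atBot.comp ?_)
      exact (Filter.tendsto_pow_atTop two_ne_zero).const_mul_atTop_of_neg (by norm_num)
  have h4 : ∫ t in Set.Ioi b, Real.exp (-(3 / 4) * t ^ 2) ≤
      ∫ t in Set.Ioi b, b⁻¹ * (t * Real.exp (-(3 / 4) * t ^ 2)) := by
    refine setIntegral_mono_on (integrable_exp_neg_mul_sq (by norm_num)).integrableOn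
      (hi.const_mul _) measurableSet_Ioi fun t ht => ?_
    rw [← mul_assoc]
    refine le_mul_of_one_le_left (Real.exp_pos _).le ?_
    rw [inv_mul_eq_div, one_le_div hb]
    exact le_of_lt ht
  rw [integral_const_mul, h3] at h4
  rw [h1, h2]
  calc _ ≤ 2 * (b⁻¹ * (2 / 3 * Real.exp (-(3 / 4) * b ^ 2))) := by gcongr
    _ = _ := by ring

lemma euclid_integral_prod {n : ℕ} (f : Fin n → ℝ → ℝ) :
    ∫ x : EuclideanSpace ℝ (Fin n), ∏ i, f i (x i) = ∏ i, ∫ t, f i t := by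
  rw [← integral_fintype_prod_volume_eq_prod, ← (PiLp.volume_preserving_toLp (Fin n)).integral_comp
    (MeasurableEquiv.toLp 2 _).measurableEmbedding]

lemma euclid_integrable_prod {n : ℕ} {f : Fin n → ℝ → ℝ} (hf : ∀ i, Integrable (f i)) :
    Integrable (fun x : EuclideanSpace ℝ (Fin n) => ∏ i, f i (x i)) := by
  rw [← (PiLp.volume_preserving_toLp (Fin n)).integrable_comp_emb
    (MeasurableEquiv.toLp 2 _).measurableEmbedding]
  exact Integrable.fintype_prod hf

/-- Real-valued version of `hermitePhi`. -/
noncomputable def rPhi {n : ℕ} (α : Fin n → ℕ) (x : EuclideanSpace ℝ (Fin n)) : ℝ :=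
  ∏ j, hermiteFn (α j) (x j)

lemma hermitePhi_eq {n : ℕ} (α : Fin n → ℕ) (x : EuclideanSpace ℝ (Fin n)) :
    hermitePhi α x = (rPhi α x : ℂ) := by
  simp [hermitePhi, rPhi]

lemma rPhi_integrable {n : ℕ} (α β : Fin n → ℕ) :
    Integrable (fun x : EuclideanSpace ℝ (Fin n) => rPhi α x * rPhi β x) := by
  simp only [rPhi, ← Finset.prod_mul_distrib]
  exact euclid_integrable_prod (f := fun j t => hermiteFn (α j) t * hermiteFn (β j) t)
    fun j => hermiteFn_integrable _ _

lemma rPhi_orth {n : ℕ} (α β : Fin n → ℕ) :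
    ∫ x : EuclideanSpace ℝ (Fin n), rPhi α x * rPhi β x = if α = β then 1 else 0 := by
  simp only [rPhi, ← Finset.prod_mul_distrib]
  rw [euclid_integral_prod (f := fun j t => hermiteFn (α j) t * hermiteFn (β j) t)]
  simp only [hermiteFn_orth]
  split_ifs with h
  · subst h; simp
  · obtain ⟨j, hj⟩ := Function.ne_iff.1 h
    exact Finset.prod_eq_zero (Finset.mem_univ j) (if_neg hj)

lemma parseval {n : ℕ} (t : Finset (Fin n → ℕ)) (c : t → ℂ) :
    ∫ x : EuclideanSpace ℝ (Fin n), ‖∑ i, c i * (rPhi i.1 x : ℂ)‖ ^ 2 = ∑ i, ‖c i‖ ^ 2 := by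
  rw [← Complex.ofReal_inj, ← integral_complex_ofReal]
  have h : ∀ x : EuclideanSpace ℝ (Fin n),
      ((‖∑ i, c i * (rPhi i.1 x : ℂ)‖ ^ 2 : ℝ) : ℂ) =
      ∑ i, ∑ j, (c i * (starRingEnd ℂ) (c j)) * ((rPhi i.1 x * rPhi j.1 x : ℝ) : ℂ) := by
    intro x
    push_cast
    rw [← Complex.mul_conj', map_sum, Finset.sum_mul_sum]
    refine Finset.sum_congr rfl fun i _ => Finset.sum_congr rfl fun j _ => ?_
    rw [map_mul, Complex.conj_ofReal]
    ring
  have hi : ∀ i j : t, Integrable (fun x : EuclideanSpace ℝ (Fin n) =>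
      (c i * (starRingEnd ℂ) (c j)) * ((rPhi i.1 x * rPhi j.1 x : ℝ) : ℂ)) :=
    fun i j => (rPhi_integrable i.1 j.1).ofReal.const_mul _
  simp_rw [h]
  rw [integral_finsetSum _ fun i _ => integrable_finsetSum _ fun j _ => hi i j]
  rw [Complex.ofReal_sum]
  refine Finset.sum_congr rfl fun i _ => ?_
  rw [integral_finsetSum _ fun j _ => hi i j]
  simp_rw [integral_const_mul, integral_complex_ofReal, rPhi_orth]
  rw [Finset.sum_eq_single i]
  · simp [Complex.mul_conj']
  · intro j _ hj
    rw [if_neg (fun h => hj (Subtype.ext h.symm))]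
    simp
  · simp

lemma kernel_bound {n N : ℕ} (t : Finset (Fin n → ℕ)) (ht : ∀ α ∈ t, ∑ j, α j ≤ N)
    (x : EuclideanSpace ℝ (Fin n)) :
    ∑ α ∈ t, rPhi α x ^ 2 ≤
      8 ^ N * ∏ j, (Real.sqrt (4 / (3 * Real.pi)) * Real.exp (-(3 / 4) * x j ^ 2)) := by
  have h1 : ∀ α ∈ t, rPhi α x ^ 2 ≤
      8 ^ N * ∏ j, ((1 / 8 : ℝ) ^ (α j) * hermiteFn (α j) (x j) ^ 2) := by
    intro α hα
    rw [Finset.prod_mul_distrib, Finset.prod_pow_eq_pow_sum, Finset.prod_pow, ← mul_assoc]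
    refine le_mul_of_one_le_left (sq_nonneg _) ?_
    rw [one_div, inv_pow, ← div_eq_mul_inv, one_le_div (by positivity)]
    exact pow_le_pow_right₀ (by norm_num) (ht α hα)
  have hsub : t ⊆ Fintype.piFinset (fun _ : Fin n => Finset.range (N + 1)) := by
    intro α hα
    simp only [Fintype.mem_piFinset, Finset.mem_range]
    intro j
    have := Finset.single_le_sum (f := α) (fun i _ => Nat.zero_le _) (Finset.mem_univ j)
    have := ht α hα
    omega
  refine (Finset.sum_le_sum h1).trans ?_
  rw [← Finset.mul_sum]
  refine mul_le_mul_of_nonneg_left ?_ (by positivity)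
  refine (Finset.sum_le_sum_of_subset_of_nonneg hsub fun α _ _ =>
    Finset.prod_nonneg fun j _ => by positivity).trans ?_
  rw [← Finset.prod_univ_sum (fun _ : Fin n => Finset.range (N + 1))
    (fun j k => (1 / 8 : ℝ) ^ k * hermiteFn k (x j) ^ 2)]
  exact Finset.prod_le_prod (fun j _ => Finset.sum_nonneg fun k _ => by positivity)
    fun j _ => mehler_bound _ _

lemma exists_coord_large {n : ℕ} (hn : 1 ≤ n) {b : ℝ} (hb : 0 < b)
    (x : EuclideanSpace ℝ (Fin n)) (hx : Real.sqrt n * b ≤ ‖x‖) : ∃ j, b ≤ |x j| := by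
  by_contra! hcon
  have hn' : (0 : ℝ) < n := by exact_mod_cast hn
  have : Nonempty (Fin n) := ⟨⟨0, hn⟩⟩
  have h1 : ‖x‖ ^ 2 < n * b ^ 2 := by
    rw [EuclideanSpace.norm_sq_eq]
    calc ∑ i, ‖x i‖ ^ 2 < ∑ _i : Fin n, b ^ 2 := by
          refine Finset.sum_lt_sum_of_nonempty Finset.univ_nonempty fun i _ => ?_
          exact pow_lt_pow_left₀ (hcon i) (abs_nonneg _) two_ne_zero
      _ = n * b ^ 2 := by simp
  have h2 := pow_le_pow_left₀ (by positivity) hx 2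
  rw [mul_pow, Real.sq_sqrt hn'.le] at h2
  linarith


/-- **Quantitative tail estimate for finite combinations of Hermite functions.** For every
`n ≥ 1`, `N ∈ ℕ`, `f ∈ E_N` and every `a ≥ √n √(2N+1)`,
`∫_{|x| ≥ a} |f(x)|² dx ≤ (2ⁿ n^{3/2} / √π) (e^{-a²/(2n)} / a) 8^N ‖f‖²_{L²(ℝⁿ)}`. -/
theorem hermite_combination_tail_quantitative (n : ℕ) (hn : 1 ≤ n) (N : ℕ)
    (f : EuclideanSpace ℝ (Fin n) → ℂ) (hf : f ∈ hermiteSpan n N)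
    (a : ℝ) (ha : Real.sqrt n * Real.sqrt (2 * N + 1) ≤ a) :
    (∫ x in {x : EuclideanSpace ℝ (Fin n) | a ≤ ‖x‖}, ‖f x‖ ^ 2) ≤
      2 ^ n * (n : ℝ) ^ ((3 : ℝ) / 2) / Real.sqrt Real.pi *
        (Real.exp (-a ^ 2 / (2 * n)) / a) * 8 ^ N * ∫ x, ‖f x‖ ^ 2 := by
  have hn' : (0 : ℝ) < n := by exact_mod_cast hn
  have hs : 0 < Real.sqrt n := Real.sqrt_pos.2 hn'
  have ha0 : 0 < a := lt_of_lt_of_le (by positivity) ha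
  obtain ⟨b, rfl⟩ : ∃ b, a = Real.sqrt n * b := ⟨a / Real.sqrt n, by field_simp⟩
  have hb : 0 < b := pos_of_mul_pos_right ha0 hs.le
  -- expansion of `f`
  have hset : {f : EuclideanSpace ℝ (Fin n) → ℂ | ∃ α : Fin n → ℕ,
      (∑ j, α j) ≤ N ∧ f = hermitePhi α} = hermitePhi '' {α : Fin n → ℕ | ∑ j, α j ≤ N} := by
    ext g
    simp only [Set.mem_ofPred_eq, Set.mem_image, eq_comm]
  rw [hermiteSpan, hset, Submodule.mem_span_image_iff_exists_fun] at hf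
  obtain ⟨t, ht, c, rfl⟩ := hf
  have hfx : ∀ x, (∑ i : t, c i • hermitePhi i.1) x = ∑ i : t, c i * (rPhi i.1 x : ℂ) := by
    intro x
    simp [Finset.sum_apply, hermitePhi_eq]
  simp_rw [hfx]
  rw [parseval]
  set M := ∑ i, ‖c i‖ ^ 2 with hM
  have hM0 : 0 ≤ M := Finset.sum_nonneg fun i _ => by positivity
  set B := Real.sqrt (4 / (3 * Real.pi)) with hB
  set g : ℝ → ℝ := fun s => B * Real.exp (-(3 / 4) * s ^ 2) with hg
  have hg0 : ∀ s, 0 ≤ g s := fun s => by positivity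
  -- pointwise bound
  have hpt : ∀ x : EuclideanSpace ℝ (Fin n),
      ‖∑ i : t, c i * (rPhi i.1 x : ℂ)‖ ^ 2 ≤ M * (8 ^ N * ∏ j, g (x j)) := by
    intro x
    calc ‖∑ i : t, c i * (rPhi i.1 x : ℂ)‖ ^ 2 ≤ (∑ i : t, ‖c i‖ * |rPhi i.1 x|) ^ 2 := by
          refine pow_le_pow_left₀ (norm_nonneg _) ((norm_sum_le _ _).trans (le_of_eq ?_)) 2
          simp
      _ ≤ M * ∑ i : t, |rPhi i.1 x| ^ 2 := Finset.sum_mul_sq_le_sq_mul_sq _ _ _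
      _ = M * ∑ α ∈ t, rPhi α x ^ 2 := by
          simp only [sq_abs]
          rw [Finset.sum_coe_sort t (fun α => rPhi α x ^ 2)]
      _ ≤ _ := mul_le_mul_of_nonneg_left (kernel_bound t ht x) hM0
  have hgi : Integrable g := (integrable_exp_neg_mul_sq (by norm_num)).const_mul _
  set gt : ℝ → ℝ := fun s => if b ≤ |s| then g s else 0 with hgt
  have hgt0 : ∀ s, 0 ≤ gt s := fun s => by
    simp only [hgt]; split_ifs
    · exact hg0 s
    · exact le_rfl
  have hmeas : MeasurableSet {s : ℝ | b ≤ |s|} :=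
    measurableSet_le measurable_const continuous_abs.measurable
  have hgti : Integrable gt := by
    have := hgi.indicator hmeas
    refine this.congr (Filter.Eventually.of_forall fun s => ?_)
    simp [Set.indicator, hgt]
  set h : Fin n → Fin n → ℝ → ℝ := fun j i => if i = j then gt else g with hh
  have hhi : ∀ j i, Integrable (h j i) := fun j i => by
    simp only [hh]; split_ifs
    · exact hgti
    · exact hgi
  have hh0 : ∀ j i s, 0 ≤ h j i s := fun j i s => by
    simp only [hh]; split_ifs
    · exact hgt0 s
    · exact hg0 s
  have hS : MeasurableSet {x : EuclideanSpace ℝ (Fin n) | Real.sqrt n * b ≤ ‖x‖} :=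
    measurableSet_le measurable_const measurable_norm
  have step1 : (∫ x in {x : EuclideanSpace ℝ (Fin n) | Real.sqrt n * b ≤ ‖x‖},
      ‖∑ i : t, c i * (rPhi i.1 x : ℂ)‖ ^ 2) ≤
      ∫ x : EuclideanSpace ℝ (Fin n), M * (8 ^ N * ∑ j, ∏ i, h j i (x i)) := by
    rw [← integral_indicator hS]
    refine integral_mono_of_nonneg (Filter.Eventually.of_forall fun x => ?_)
      (((integrable_finsetSum _ fun j _ => euclid_integrable_prod (hhi j)).const_mul _).const_mul _)
      (Filter.Eventually.of_forall fun x => ?_)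
    · exact Set.indicator_nonneg (fun x _ => by positivity) x
    · have hnn : ∀ j, 0 ≤ ∏ i, h j i (x i) := fun j => Finset.prod_nonneg fun i _ => hh0 j i _
      refine Set.indicator_apply_le' (fun hx => ?_) (fun _ => ?_)
      · obtain ⟨j, hj⟩ := exists_coord_large hn hb x hx
        refine (hpt x).trans ?_
        have e : ∏ i, g (x i) = ∏ i, h j i (x i) := by
          refine Finset.prod_congr rfl fun i _ => ?_
          by_cases hij : i = j
          · subst hij; simp [hh, hgt, hj]
          · simp [hh, hij]
        have := Finset.single_le_sum (f := fun j => ∏ i, h j i (x i)) (fun j _ => hnn j)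
          (Finset.mem_univ j)
        rw [e]
        exact mul_le_mul_of_nonneg_left (mul_le_mul_of_nonneg_left this (by positivity)) hM0
      · have := Finset.sum_nonneg fun j (_ : j ∈ Finset.univ) => hnn j
        positivity
  refine step1.trans ?_
  rw [integral_const_mul, integral_const_mul,
    integral_finsetSum _ fun j _ => euclid_integrable_prod (hhi j)]
  simp_rw [euclid_integral_prod]
  -- one-dimensional integrals
  have hpi := Real.pi_pos
  have hI : ∫ s, g s = 4 / 3 := by
    rw [hg, integral_const_mul, integral_gaussian, hB, ← Real.sqrt_mul (by positivity)]
    rw [show 4 / (3 * Real.pi) * (Real.pi / (3 / 4)) = (4 / 3 : ℝ) ^ 2 by field_simp]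
    exact Real.sqrt_sq (by norm_num)
  have hBle : B ≤ 3 / 2 / Real.sqrt Real.pi := by
    rw [hB, Real.sqrt_le_left (by positivity), div_pow, Real.sq_sqrt hpi.le]
    rw [div_le_div_iff₀ (by positivity) (by positivity)]
    nlinarith
  have hIt : ∫ s, gt s ≤ 2 / Real.sqrt Real.pi * (Real.exp (-b ^ 2 / 2) / b) := by
    have e : ∀ s, gt s = B * (if b ≤ |s| then Real.exp (-(3 / 4) * s ^ 2) else 0) := by
      intro s; simp [hgt, hg]
    simp_rw [e]
    rw [integral_const_mul]
    calc _ ≤ 3 / 2 / Real.sqrt Real.pi * (4 / 3 * (Real.exp (-b ^ 2 / 2) / b)) := by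
          refine mul_le_mul hBle ((gauss_tail b hb).trans ?_)
            (integral_nonneg fun s => by dsimp only; split_ifs <;> positivity) (by positivity)
          gcongr
          nlinarith [sq_nonneg b]
      _ = _ := by ring
  have hprod : ∀ j, ∏ i, ∫ s, h j i s = (∫ s, gt s) * (4 / 3) ^ (n - 1) := by
    intro j
    rw [← Finset.mul_prod_erase _ _ (Finset.mem_univ j)]
    have : ∀ i ∈ Finset.univ.erase j, ∫ s, h j i s = 4 / 3 := by
      intro i hi
      simp only [hh, if_neg (Finset.ne_of_mem_erase hi), hI]
    rw [Finset.prod_congr rfl this]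
    rw [Finset.prod_const, Finset.card_erase_of_mem (Finset.mem_univ j), Finset.card_univ,
      Fintype.card_fin]
    simp only [hh, if_true]
  simp_rw [hprod]
  rw [Finset.sum_const, Finset.card_univ, Fintype.card_fin, nsmul_eq_mul]
  have hpow : (4 / 3 : ℝ) ^ (n - 1) ≤ 2 ^ (n - 1) := by gcongr; norm_num
  have h2n : (2 : ℝ) ^ n = 2 * 2 ^ (n - 1) := by
    rw [← pow_succ']; congr 1; omega
  have hrp : (n : ℝ) ^ ((3 : ℝ) / 2) = n * Real.sqrt n := by
    rw [Real.sqrt_eq_rpow, ← Real.rpow_one_add' hn'.le (by norm_num)]; norm_num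
  have hex : -(Real.sqrt n * b) ^ 2 / (2 * n) = -b ^ 2 / 2 := by
    rw [mul_pow, Real.sq_sqrt hn'.le]; field_simp
  rw [hex, hrp, h2n]
  calc _ ≤ M * (8 ^ N * (n * (2 / Real.sqrt Real.pi * (Real.exp (-b ^ 2 / 2) / b) *
        2 ^ (n - 1)))) := by gcongr
    _ = _ := by field_simp
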